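/- arXiv:0806.4510 — 2 statements merged into one kernel-verified Lean document; each statement's English description precedes it below -/
import Mathlib

section
/- (Footprint bound.) Let K be a field, fix a monomial ordering ≺ on the monomials in the variables X_1, …, X_n, and let F_1, …, F_s be polynomials in K[X_1, …, X_n] generating the ideal I. Let Δ_≺(I) be the footprint of I, i.e., the set of monomials that do not occur as the leading monomial of any nonzero polynomial in I. If Δ_≺(I) is a finite set, then the set of common zeros of F_1, …, F_s in (the n-fold product of) an algebraic closure of K is finite and has cardinality at most |Δ_≺(I)|. -/
/-- The leading monomial (exponent vector) of a polynomial `f` with respect to a monomial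
order `m`: the `m`-largest element of the support of `f` (and `0` for the zero polynomial). -/
noncomputable def leadingExp {σ K : Type*} [CommSemiring K] (m : MonomialOrder σ)
    (f : MvPolynomial σ K) : σ →₀ ℕ :=
  m.toSyn.symm (f.support.sup fun d => m.toSyn d)

/-- The footprint `Δ_≺(I)` of an ideal `I` with respect to a monomial order: the set of
monomials (exponent vectors) that are not the leading monomial of any nonzero element of `I`. -/
def footprint {σ K : Type*} [CommSemiring K] (m : MonomialOrder σ)
    (I : Ideal (MvPolynomial σ K)) : Set (σ →₀ ℕ) :=
  {d | ∀ g ∈ I, g ≠ 0 → leadingExp m g ≠ d}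

open MvPolynomial in
/-- The monomial evaluation character attached to a point. -/
noncomputable def pointChar {σ L : Type*} [Field L] (x : σ → L) :
    Multiplicative (σ →₀ ℕ) →* L where
  toFun d := MvPolynomial.eval x (monomial d.toAdd 1)
  map_one' := by
    change MvPolynomial.eval x (monomial 0 1) = 1
    simp
  map_mul' a b := by
    rw [← map_mul, monomial_mul, one_mul]
    rfl

open MvPolynomial in
lemma pointChar_injective {σ L : Type*} [Field L] :
    Function.Injective (pointChar : (σ → L) → _) := by
  intro x y h
  funext i
  have := DFunLike.congr_fun h (Multiplicative.ofAdd (Finsupp.single i 1))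
  change MvPolynomial.eval x (X i) = MvPolynomial.eval y (X i) at this
  simpa using this

open MvPolynomial in
lemma vanish_all {σ K L : Type*} [Field K] [Field L] [Algebra K L] (m : MonomialOrder σ)
    (I : Ideal (MvPolynomial σ K)) (φ : MvPolynomial σ K →ₗ[K] L)
    (hI : ∀ g ∈ I, φ g = 0)
    (hΔ : ∀ d ∈ footprint m I, φ (monomial d 1) = 0) (d : σ →₀ ℕ) :
    φ (monomial d 1) = 0 := by
  obtain ⟨e, rfl⟩ := m.toSyn.symm.surjective d
  induction e using WellFoundedLT.induction with
  | ind e ih =>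
  by_cases hd : m.toSyn.symm e ∈ footprint m I
  · exact hΔ _ hd
  · simp only [footprint, Set.mem_setOf_eq, not_forall, not_not] at hd
    obtain ⟨g, hg, hg0, hge⟩ := hd
    change m.degree g = _ at hge
    rw [← hge]
    have h1 := hI g hg
    rw [g.as_sum, map_sum, Finset.sum_eq_single (m.degree g)] at h1
    · rw [← mul_one (coeff _ g), ← smul_eq_mul, ← smul_monomial, map_smul] at h1
      exact (smul_eq_zero.mp h1).resolve_left (m.coeff_degree_ne_zero_iff.mpr hg0)
    · intro b hb hne
      rw [← mul_one (coeff _ g), ← smul_eq_mul, ← smul_monomial, map_smul]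
      have := ih (m.toSyn b) (by
        have h2 := m.le_degree hb
        rw [hge] at h2 hne
        simp only [AddEquiv.apply_symm_apply] at h2
        refine lt_of_le_of_ne h2 ?_
        rintro rfl
        simp at hne)
      rw [AddEquiv.symm_apply_apply] at this
      rw [this, smul_zero]
    · intro h
      exact absurd (m.degree_mem_support hg0) h

open MvPolynomial in
lemma zeros_linearIndependent {σ K L : Type*} [Field K] [Field L] [Algebra K L]
    (m : MonomialOrder σ) (I : Ideal (MvPolynomial σ K)) (Z : Set (σ → L))
    (hZ : ∀ x ∈ Z, ∀ g ∈ I, aeval x g = 0) :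
    LinearIndependent L (fun (x : Z) (d : footprint m I) => pointChar x.1 (.ofAdd d.1)) := by
  rw [linearIndependent_iff']
  intro s c hc
  have key := (linearIndependent_monoidHom (Multiplicative (σ →₀ ℕ)) L).comp
    (fun x : Z => pointChar x.1) (pointChar_injective.comp Subtype.val_injective)
  rw [linearIndependent_iff'] at key
  apply key s c
  let φ : MvPolynomial σ K →ₗ[K] L :=
    ∑ x ∈ s, c x • (aeval (R := K) x.1).toLinearMap
  have hφ : ∀ d, φ (monomial d 1) = ∑ x ∈ s, c x * pointChar x.1 (.ofAdd d) := by
    intro d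
    simp [φ, pointChar, aeval_monomial, eval_monomial]
  funext d
  have := vanish_all m I φ (by
    intro g hg
    simp only [φ, LinearMap.sum_apply, LinearMap.smul_apply, AlgHom.toLinearMap_apply]
    exact Finset.sum_eq_zero fun x _ => by rw [hZ x.1 x.2 g hg, smul_zero]) (by
    intro d hd
    rw [hφ]
    simpa using congrFun hc ⟨d, hd⟩) d.toAdd
  rw [hφ] at this
  simpa using this

/-- The footprint bound: if the footprint of the ideal generated by `F_1, …, F_s` is finite,
then the set of common zeros of `F_1, …, F_s` in an algebraic closure of `K` is finite, of
cardinality at most the cardinality of the footprint. -/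
theorem footprint_bound {K : Type*} [Field K] (n s : ℕ) (m : MonomialOrder (Fin n))
    (Fs : Fin s → MvPolynomial (Fin n) K)
    (hfin : (footprint m (Ideal.span (Set.range Fs))).Finite) :
    {x : Fin n → AlgebraicClosure K |
        ∀ i : Fin s, MvPolynomial.eval x
          (MvPolynomial.map (algebraMap K (AlgebraicClosure K)) (Fs i)) = 0}.Finite ∧
    {x : Fin n → AlgebraicClosure K |
        ∀ i : Fin s, MvPolynomial.eval x
          (MvPolynomial.map (algebraMap K (AlgebraicClosure K)) (Fs i)) = 0}.ncard ≤
      (footprint m (Ideal.span (Set.range Fs))).ncard := by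
  set Z := {x : Fin n → AlgebraicClosure K |
        ∀ i : Fin s, MvPolynomial.eval x
          (MvPolynomial.map (algebraMap K (AlgebraicClosure K)) (Fs i)) = 0} with hZdef
  have hZ : ∀ x ∈ Z, ∀ g ∈ Ideal.span (Set.range Fs), MvPolynomial.aeval x g = 0 := by
    intro x hx g hg
    have : Ideal.span (Set.range Fs) ≤ RingHom.ker (MvPolynomial.aeval (R := K) x) := by
      rw [Ideal.span_le]
      rintro _ ⟨i, rfl⟩
      have := hx i
      rw [MvPolynomial.eval_map] at this
      exact this
    exact this hg
  have li := zeros_linearIndependent m _ Z hZ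
  have := hfin.fintype
  have hf : Finite Z := li.finite
  have := Fintype.ofFinite Z
  refine ⟨Set.toFinite Z, ?_⟩
  have h := li.fintype_card_le_finrank
  rw [Module.finrank_fintype_fun_eq_card] at h
  rwa [← Nat.card_coe_set_eq, ← Nat.card_coe_set_eq, Nat.card_eq_fintype_card,
    Nat.card_eq_fintype_card]
end

section
/- Let F be a finite field with q elements and let R be a nonzero polynomial in F[X_1, …, X_μ] whose degree in each variable X_i is at most q−1. Then the number of points (x_1, …, x_μ) in F^μ with R(x_1, …, x_μ) ≠ 0 is at least the minimum, taken over all monomials X_1^{s_1}⋯X_μ^{s_μ} in the support of R, of the product (q−s_1)(q−s_2)⋯(q−s_μ). -/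
open MvPolynomial in
theorem exists_support_prod_le {F : Type*} [Field F] [Fintype F] [DecidableEq F] (n : ℕ)
    (R : MvPolynomial (Fin n) F) (hR : R ≠ 0) :
    ∃ s ∈ R.support, ∏ v : Fin n, (Fintype.card F - s v) ≤
      (Finset.univ.filter (fun x : Fin n → F => MvPolynomial.eval x R ≠ 0)).card := by
  induction n with
  | zero =>
    obtain ⟨s, hs⟩ := MvPolynomial.support_nonempty.2 hR
    refine ⟨s, hs, ?_⟩
    simp only [Finset.univ_eq_empty, Finset.prod_empty]
    rw [Finset.one_le_card]
    refine ⟨Fin.elim0, ?_⟩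
    simp only [Finset.mem_filter, Finset.mem_univ, true_and]
    intro h
    apply hR
    rw [MvPolynomial.eq_C_of_isEmpty R] at h ⊢
    rw [MvPolynomial.eval_C] at h
    rw [h, MvPolynomial.C_0]
  | succ n ih =>
    set P := finSuccEquiv F n R with hP
    have hP0 : P ≠ 0 := by
      rw [hP]
      exact (map_ne_zero_iff _ (finSuccEquiv F n).injective).2 hR
    obtain ⟨s, hs, hle⟩ := ih P.leadingCoeff (Polynomial.leadingCoeff_ne_zero.2 hP0)
    refine ⟨s.cons P.natDegree, mem_support_coeff_finSuccEquiv.1 hs, ?_⟩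
    rw [Fin.prod_univ_succ]
    simp only [Finsupp.cons_zero, Finsupp.cons_succ]
    set A := Finset.univ.filter (fun x : Fin n → F => MvPolynomial.eval x P.leadingCoeff ≠ 0)
    let B : (Fin n → F) → Finset F := fun x =>
      Finset.univ.filter (fun a : F => (P.map (MvPolynomial.eval x)).eval a ≠ 0)
    have hB : ∀ x ∈ A, Fintype.card F - P.natDegree ≤ (B x).card := by
      intro x hx
      have hx' : MvPolynomial.eval x P.leadingCoeff ≠ 0 := by simpa [A] using hx
      have hne : P.map (MvPolynomial.eval x) ≠ 0 := by
        intro h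
        apply hx'
        have := congrArg (fun p => Polynomial.coeff p P.natDegree) h
        simpa [Polynomial.coeff_map] using this
      have h1 : (B x)ᶜ ⊆ (P.map (MvPolynomial.eval x)).roots.toFinset := by
        intro a ha
        simp only [B, Finset.mem_compl, Finset.mem_filter, Finset.mem_univ, true_and,
          not_not] at ha
        rw [Multiset.mem_toFinset, Polynomial.mem_roots hne]
        exact ha
      have h2 := Finset.card_le_card h1
      have h3 := Multiset.toFinset_card_le (P.map (MvPolynomial.eval x)).roots
      have h4 := Polynomial.card_roots' (P.map (MvPolynomial.eval x))
      have h5 : (P.map (MvPolynomial.eval x)).natDegree ≤ P.natDegree :=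
        Polynomial.natDegree_map_le
      rw [Finset.card_compl] at h2
      omega
    calc (Fintype.card F - P.natDegree) * ∏ v : Fin n, (Fintype.card F - s v)
        ≤ (Fintype.card F - P.natDegree) * A.card := Nat.mul_le_mul_left _ hle
      _ ≤ ∑ x ∈ A, (B x).card := by
        rw [mul_comm]
        simpa using Finset.card_nsmul_le_sum A (fun x => (B x).card) _ hB
      _ = (A.sigma B).card := (Finset.card_sigma _ _).symm
      _ ≤ _ := by
        apply Finset.card_le_card_of_injOn (fun p => (Fin.cons p.2 p.1 : Fin (n + 1) → F))
        · intro p hp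
          have hp2 := (Finset.mem_sigma.1 hp).2
          simp only [B, Finset.mem_filter, Finset.mem_univ, true_and] at hp2
          simp only [Finset.coe_filter, Finset.mem_univ, true_and, Set.mem_ofPred_eq]
          rw [eval_eq_eval_mv_eval']
          exact hp2
        · rintro ⟨x, a⟩ _ ⟨y, b⟩ _ h
          obtain ⟨h1, h2⟩ := Fin.cons_injective2 h
          subst h1
          subst h2
          rfl

/-- Let `F` be a finite field with `q` elements and let `R ∈ F[X_1, …, X_μ]` be a nonzero
polynomial whose degree in each variable is at most `q - 1`.  Then the number of points of
`F^μ` where `R` is nonzero is at least the minimum, over all monomials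
`X_1^{s_1} ⋯ X_μ^{s_μ}` in the support of `R`, of `(q - s_1) ⋯ (q - s_μ)`. -/
theorem card_nonzeros_ge_min_over_support {F : Type*} [Field F] [Fintype F] (q μ : ℕ)
    (hq : Fintype.card F = q) (R : MvPolynomial (Fin μ) F) (hR : R ≠ 0)
    (hdeg : ∀ i : Fin μ, R.degreeOf i ≤ q - 1) :
    R.support.inf' (by simpa [Finset.nonempty_iff_ne_empty, MvPolynomial.support_eq_empty]
        using hR) (fun s => ∏ v : Fin μ, (q - s v)) ≤
      {x : Fin μ → F | MvPolynomial.eval x R ≠ 0}.ncard := by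
  classical
  subst hq
  obtain ⟨s, hs, hle⟩ := exists_support_prod_le μ R hR
  refine (Finset.inf'_le _ hs).trans (hle.trans (le_of_eq ?_))
  rw [← Set.ncard_coe_finset]
  congr 1
  ext x
  simp
end
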